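/- arXiv:1611.02832 — 6 statements merged into one kernel-verified Lean document; each statement's English description precedes it below -/
import Mathlib

section
/- For every finite field K with q elements there exists an element a of an algebraic closure Ω of K whose degree over K is exactly 7 such that, writing a_i = a^{q^i} for i = 0, …, 6 and p_i = (a_i³ : a_i : 1) ∈ P²(Ω), the seven points p_0, …, p_6 are pairwise distinct, no three of them are collinear, and no six of them lie on a conic. (These are the seven Galois-conjugate points whose blowup is a del Pezzo surface of degree 2 of type 39.) -/
/-- The seven Galois-conjugate points `p_i = (a^{q^i}³ : a^{q^i} : 1)` of `P²`,
given as vectors in `Ω³`, for `i = 0, …, 6`. -/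
def conjPts (Ω : Type*) [Field Ω] (q : ℕ) (a : Ω) (i : Fin 7) : Fin 3 → Ω :=
  ![(a ^ q ^ (i : ℕ)) ^ 3, a ^ q ^ (i : ℕ), 1]

open Polynomial in
/-- If the iterated Frobenius images of `x`, as many as the degree of a finite extension `L`, are
linearly independent over the finite field `K`, then `x` generates `L`. -/
theorem natDegree_minpoly_of_linearIndependent_conjugates
    {K L : Type*} [Field K] [Fintype K] [Field L] [Algebra K L] [FiniteDimensional K L] {x : L}
    (hli : LinearIndependent K
      fun i : Fin (Module.finrank K L) ↦ x ^ Fintype.card K ^ (i : ℕ)) :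
    (minpoly K x).natDegree = Module.finrank K L := by
  have hint : IsIntegral K x := Algebra.IsIntegral.isIntegral x
  refine le_antisymm (minpoly.natDegree_le x) (not_lt.mp fun hlt ↦ ?_)
  refine ((minpoly.monic hint).map (algebraMap K L)).ne_zero
    (eq_zero_of_natDegree_lt_card_of_eval_eq_zero _ hli.injective (fun i ↦ ?_) ?_)
  · have h := aeval_algHom_apply (FiniteField.frobeniusAlgHom K L ^ (i : ℕ)) x (minpoly K x)
    rw [minpoly.aeval, map_zero, AlgHom.coe_pow, FiniteField.coe_frobeniusAlgHom,
      pow_iterate] at h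
    rwa [eval_map_algebraMap]
  · simpa using hlt

/-- A finite extension of a finite field `K` has an element whose conjugates are linearly
independent over `K`. -/
theorem exists_linearIndependent_pow_card_pow
    (K L : Type*) [Field K] [Fintype K] [Field L] [Finite L] [Algebra K L] :
    ∃ x : L, LinearIndependent K
      fun i : Fin (Module.finrank K L) ↦ x ^ Fintype.card K ^ (i : ℕ) := by
  obtain ⟨x, hx⟩ := exists_linearIndependent_algEquiv_apply K L
  refine ⟨x, ?_⟩
  convert! hx.comp _ (FiniteField.bijective_frobeniusAlgEquivOfAlgebraic_pow K L).1 using 2 with i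
  simp [AlgEquiv.coe_pow, FiniteField.coe_frobeniusAlgEquivOfAlgebraic_iterate]

/-- A finite field has in each degree `n > 0` an element whose `n` conjugates are linearly
independent over it. -/
theorem exists_linearIndependent_conjugates
    (K : Type*) [Field K] [Fintype K] (n : ℕ) [NeZero n] :
    ∃ a : AlgebraicClosure K, (minpoly K a).natDegree = n ∧
      LinearIndependent K fun i : Fin n ↦ a ^ Fintype.card K ^ (i : ℕ) := by
  obtain ⟨p, hp⟩ := CharP.exists K
  have : Fact p.Prime := ⟨CharP.char_is_prime K p⟩
  obtain ⟨L, _, _, _, hrank⟩ : ∃ (L : Type) (_ : Field L) (_ : Finite L) (_ : Algebra K L),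
      Module.finrank K L = n :=
    ⟨FiniteField.Extension K p n, inferInstance, inferInstance, inferInstance,
      FiniteField.finrank_extension K p n⟩
  subst hrank
  obtain ⟨x, hx⟩ := exists_linearIndependent_pow_card_pow K L
  let f : L →ₐ[K] AlgebraicClosure K := IsAlgClosed.lift
  refine ⟨f x, ?_, ?_⟩
  · rw [minpoly.algHom_eq f f.injective, natDegree_minpoly_of_linearIndependent_conjugates hx]
  · simpa [Function.comp_def] using hx.map' f.toLinearMap (LinearMap.ker_eq_bot.mpr f.injective)

/-- Three distinct points of the cuspidal cubic `x z² = y³` whose parameters have nonzero sum are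
not collinear. -/
theorem linearIndependent_cuspidal_cubic {F : Type*} [Field F] {a b c : F}
    (hab : a ≠ b) (hac : a ≠ c) (hbc : b ≠ c) (h : a + b + c ≠ 0) :
    LinearIndependent F ![![a ^ 3, a, 1], ![b ^ 3, b, 1], ![c ^ 3, c, 1]] := by
  refine Matrix.linearIndependent_rows_of_det_ne_zero
    (A := Matrix.of ![![a ^ 3, a, 1], ![b ^ 3, b, 1], ![c ^ 3, c, 1]]) ?_
  have hdet : (Matrix.of ![![a ^ 3, a, 1], ![b ^ 3, b, 1], ![c ^ 3, c, 1]]).det =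
      (a - b) * (a - c) * (b - c) * (a + b + c) := by
    simp [Matrix.det_fin_three]
    ring
  rw [hdet]
  exact mul_ne_zero (mul_ne_zero (mul_ne_zero (sub_ne_zero.mpr hab) (sub_ne_zero.mpr hac))
    (sub_ne_zero.mpr hbc)) h

open Polynomial in
/-- A polynomial of degree at most six without quintic term that vanishes at six distinct points
with nonzero sum is zero. -/
theorem eq_zero_of_eval_six_eq_zero {F : Type*} [Field F] {P : F[X]} (hP : P.natDegree ≤ 6)
    (hP5 : P.coeff 5 = 0) {t : Fin 6 → F} (ht : Function.Injective t) (hsum : ∑ m, t m ≠ 0)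
    (h : ∀ m, P.eval (t m) = 0) : P = 0 := by
  set Q : F[X] := ∏ m, (X - C (t m)) with hQ
  have hQdeg : Q.natDegree = 6 := by simp [hQ, natDegree_prod_of_monic, monic_X_sub_C]
  have hQmonic : Q.Monic := monic_prod_of_monic _ _ fun m _ ↦ monic_X_sub_C _
  have hQ6 : Q.coeff 6 = 1 := hQdeg ▸ hQmonic.coeff_natDegree
  have hQ5 : Q.coeff 5 = -∑ m, t m := by
    simpa using prod_X_sub_C_coeff_card_pred Finset.univ t (by simp)
  have hPQ : P - C (P.coeff 6) * Q = 0 := by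
    refine eq_zero_of_natDegree_lt_card_of_eval_eq_zero _ ht (fun m ↦ ?_) ?_
    · simp [h, hQ, eval_prod, Finset.prod_eq_zero (Finset.mem_univ m)]
    · rw [Fintype.card_fin, Nat.lt_succ_iff]
      refine natDegree_le_pred (n := 6) ?_ (by simp [hQ6])
      exact (natDegree_sub_le_of_le hP ((natDegree_C_mul_le _ _).trans hQdeg.le)).trans (by simp)
  have hP6 : P.coeff 6 = 0 := by
    have := congrArg (fun R ↦ coeff R 5) hPQ
    simpa [hP5, hQ5, hsum] using this
  simpa [hP6] using hPQ

open Polynomial in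
/-- No conic passes through six distinct points of the cuspidal cubic `x z² = y³` whose parameters
have nonzero sum. -/
theorem conic_eq_zero_of_cuspidal_cubic {F : Type*} [Field F] {t : Fin 6 → F}
    (ht : Function.Injective t) (hsum : ∑ m, t m ≠ 0) {A B C D E G : F}
    (h : ∀ m, A * (t m ^ 3) ^ 2 + B * t m ^ 2 + C * 1 ^ 2 + D * t m ^ 3 * t m +
      E * t m ^ 3 * 1 + G * t m * 1 = 0) :
    A = 0 ∧ B = 0 ∧ C = 0 ∧ D = 0 ∧ E = 0 ∧ G = 0 := by
  set P : F[X] := monomial 6 A + monomial 4 D + monomial 3 E + monomial 2 B + monomial 1 G +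
    monomial 0 C with hPdef
  have hP : P = 0 := by
    refine eq_zero_of_eval_six_eq_zero ?_ ?_ ht hsum fun m ↦ ?_
    · simp only [natDegree_le_iff_coeff_eq_zero, hPdef, coeff_add, coeff_monomial]
      intro k hk
      grind
    · simp [hPdef, coeff_monomial]
    · rw [← h m]
      simp only [hPdef, eval_add, eval_monomial]
      ring
  have hc (k : ℕ) : P.coeff k = 0 := by simp [hP]
  simp only [hPdef, coeff_add, coeff_monomial] at hc
  exact ⟨by simpa using hc 6, by simpa using hc 2, by simpa using hc 0, by simpa using hc 4,
    by simpa using hc 3, by simpa using hc 1⟩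

/-- For every finite field `K` with `q` elements there is an element `a` of an
algebraic closure `Ω` of `K` of degree exactly `7` over `K` such that, writing
`p_i = ((a^{q^i})³ : a^{q^i} : 1) ∈ P²(Ω)` for `i = 0, …, 6`, the seven points are
pairwise distinct (no two representing vectors are proportional), no three of them
are collinear (any three representing vectors are linearly independent), and no
six of them lie on a conic (no nonzero quadratic form
`A x² + B y² + C z² + D xy + E xz + G yz` vanishes on six of them). -/
theorem exists_degree_seven_point_in_general_position
    (K : Type*) [Field K] [Fintype K] (q : ℕ) (hq : q = Fintype.card K) :
    ∃ a : AlgebraicClosure K,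
      (minpoly K a).natDegree = 7 ∧
      (∀ i j : Fin 7, i ≠ j → ∀ c : AlgebraicClosure K,
        conjPts (AlgebraicClosure K) q a i ≠ c • conjPts (AlgebraicClosure K) q a j) ∧
      (∀ i j k : Fin 7, i ≠ j → i ≠ k → j ≠ k →
        LinearIndependent (AlgebraicClosure K)
          ![conjPts (AlgebraicClosure K) q a i, conjPts (AlgebraicClosure K) q a j,
            conjPts (AlgebraicClosure K) q a k]) ∧
      (∀ s : Fin 6 → Fin 7, Function.Injective s →
        ∀ A B C D E G : AlgebraicClosure K,
          ¬ (A = 0 ∧ B = 0 ∧ C = 0 ∧ D = 0 ∧ E = 0 ∧ G = 0) →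
          ∃ m : Fin 6,
            A * (conjPts (AlgebraicClosure K) q a (s m) 0) ^ 2 +
            B * (conjPts (AlgebraicClosure K) q a (s m) 1) ^ 2 +
            C * (conjPts (AlgebraicClosure K) q a (s m) 2) ^ 2 +
            D * (conjPts (AlgebraicClosure K) q a (s m) 0) *
              (conjPts (AlgebraicClosure K) q a (s m) 1) +
            E * (conjPts (AlgebraicClosure K) q a (s m) 0) *
              (conjPts (AlgebraicClosure K) q a (s m) 2) +
            G * (conjPts (AlgebraicClosure K) q a (s m) 1) *
              (conjPts (AlgebraicClosure K) q a (s m) 2) ≠ 0) := by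
  subst hq
  obtain ⟨a, hdeg, hli⟩ := exists_linearIndependent_conjugates K 7
  have hinj := hli.injective
  have hsum (s : Finset (Fin 7)) (hs : s.Nonempty) :
      ∑ i ∈ s, a ^ Fintype.card K ^ (i : ℕ) ≠ 0 := by
    obtain ⟨i, hi⟩ := hs
    intro h
    exact one_ne_zero (linearIndependent_iff'.mp hli s (fun _ ↦ (1 : K)) (by simpa using h) i hi)
  refine ⟨a, hdeg, fun i j hij c h ↦ ?_, fun i j k hij hik hjk ↦ ?_,
    fun s hs A B C D E G hne ↦ ?_⟩
  · have h1 := congrFun h 1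
    have h2 := congrFun h 2
    simp only [conjPts, Pi.smul_apply, Matrix.cons_val, smul_eq_mul, mul_one] at h1 h2
    rw [← h2, one_mul] at h1
    exact hij (hinj h1)
  · refine linearIndependent_cuspidal_cubic (hinj.ne hij) (hinj.ne hik) (hinj.ne hjk) ?_
    have h := hsum {i, j, k} (by simp)
    rwa [Finset.sum_insert (by simp [hij, hik]), Finset.sum_pair hjk, ← add_assoc] at h
  · by_contra! h
    refine hne (conic_eq_zero_of_cuspidal_cubic (hinj.comp hs) ?_ h)
    have h := hsum (Finset.univ.map ⟨s, hs⟩) (by simp)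
    rwa [Finset.sum_map] at h
end

section
/- Let a ∈ L be an element not lying in K. Then a + a^q + a^{q²} ≠ 0. -/
/-- An element of an extension of a finite field `K` that is fixed by the Frobenius `x ↦ x ^ #K`
lies in `K`. -/
theorem FiniteField.mem_range_algebraMap_of_pow_card_eq {K L : Type*} [Field K] [Fintype K]
    [Field L] [Algebra K L] {a : L} (ha : a ^ Fintype.card K = a) :
    a ∈ Set.range (algebraMap K L) := by
  have h_splits : (∏ x : K, (Polynomial.X - Polynomial.C x)) =
      Polynomial.X ^ Fintype.card K - Polynomial.X := by
    have h_deg := FiniteField.X_pow_card_sub_X_natDegree_eq K (Fintype.one_lt_card (α := K))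
    have h_roots := FiniteField.roots_X_pow_card_sub_X K
    have h_monic : (Polynomial.X ^ Fintype.card K - Polynomial.X : Polynomial K).Monic :=
      Polynomial.monic_X_pow_sub (by simpa using Fintype.one_lt_card (α := K))
    have := Polynomial.prod_multiset_X_sub_C_of_monic_of_roots_card_eq h_monic
      (by rw [h_roots, h_deg]; rfl)
    rwa [h_roots] at this
  have h_prod : ∏ x : K, (a - algebraMap K L x) = 0 := by
    simpa [ha] using congrArg (Polynomial.aeval a) h_splits
  obtain ⟨x, -, hx⟩ := Finset.prod_eq_zero_iff.mp h_prod
  exact ⟨x, (sub_eq_zero.mp hx).symm⟩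

/-- Let `K` be a finite field with `q` elements and `L` a field extension of `K` of
degree `7`. If `a ∈ L` does not lie in (the image of) `K`, then
`a + a^q + a^{q²} ≠ 0`. -/
theorem add_pow_q_add_pow_q_sq_ne_zero
    (K L : Type*) [Field K] [Fintype K] [Field L] [Algebra K L]
    (q : ℕ) (hq : q = Fintype.card K)
    (hdeg : Module.finrank K L = 7)
    (a : L) (ha : a ∉ Set.range (algebraMap K L)) :
    a + a ^ q + a ^ q ^ 2 ≠ 0 := by
  subst hq
  intro h
  apply ha
  have : FiniteDimensional K L := Module.finite_of_finrank_eq_succ hdeg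
  have : Finite L := Module.finite_of_finite K
  have : Fintype L := Fintype.ofFinite L
  set F := FiniteField.frobeniusAlgHom K L
  have hFa (x : L) : F x = x ^ Fintype.card K := rfl
  have h0 : a + F a + F (F a) = 0 := by
    rw [← h]; simp only [hFa]; ring
  have h1 : F a + F (F a) + F (F (F a)) = 0 := by
    rw [← map_add, ← map_add, h0, map_zero]
  have h3 : F (F (F a)) = a := by linear_combination h1 - h0
  have h7 : F (F (F (F (F (F (F a)))))) = a := by
    have hc : a ^ Fintype.card L = a := FiniteField.pow_card a
    rw [Module.card_eq_pow_finrank (K := K), hdeg] at hc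
    simp only [hFa, ← pow_mul]
    convert hc using 2
    ring
  have h_fix : a ^ Fintype.card K = a := by
    rw [h3, h3] at h7
    exact h7
  exact FiniteField.mem_range_algebraMap_of_pow_card_eq h_fix
end

section
/- Assume q is odd. Let a ∈ L be an element not lying in K. Then a + a^q + a^{q³} ≠ 0. -/
/-- An element of an extension of a finite field `K` that is fixed by the Frobenius
`x ↦ x ^ #K` lies in `K`. -/
theorem FiniteField.mem_range_algebraMap_of_pow_card_eq_self
    {K L : Type*} [Field K] [Fintype K] [Field L] [Algebra K L]
    {a : L} (h : a ^ Fintype.card K = a) : a ∈ Set.range (algebraMap K L) := by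
  have hsplits : (Polynomial.X ^ Fintype.card K - Polynomial.X : Polynomial K).Splits := by
    simpa using (FiniteField.isSplittingField_sub K K).splits'
  exact hsplits.mem_range_of_isRoot
    (FiniteField.X_pow_card_sub_X_ne_zero K Fintype.one_lt_card) (by simp [h])

/-- If `s` is an additive map and `s^[7] a = a`, then `a + s a + s^[3] a = 0` forces
`2 * s a = 2 * a`: modulo `X ^ 7 - 1`, the polynomial `2 * (X - 1)` is a multiple of
`1 + X + X ^ 3`. -/
theorem two_mul_map_eq_of_add_map_add_map_iterate_eq_zero
    {R : Type*} [CommRing R] (s : R →+ R) {a : R} (h7 : s^[7] a = a)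
    (h : a + s a + s^[3] a = 0) : 2 * s a = 2 * a := by
  have h1 := congrArg s h
  have h4 := congrArg s^[4] h
  have h5 := congrArg s^[5] h
  have h6 := congrArg s^[6] h
  simp only [Function.iterate_succ_apply', Function.iterate_zero_apply, map_add, map_zero]
    at h1 h4 h5 h6 h7
  simp only [h7] at h4 h5 h6
  linear_combination h1 + h5 - h4 - h6

/-- Let `K` be a finite field with `q` elements, `q` odd, and `L` a field extension
of `K` of degree `7`. If `a ∈ L` does not lie in (the image of) `K`, then
`a + a^q + a^{q³} ≠ 0`. -/
theorem add_pow_q_add_pow_q_cube_ne_zero_of_odd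
    (K L : Type*) [Field K] [Fintype K] [Field L] [Algebra K L]
    (q : ℕ) (hq : q = Fintype.card K) (hodd : Odd q)
    (hdeg : Module.finrank K L = 7)
    (a : L) (ha : a ∉ Set.range (algebraMap K L)) :
    a + a ^ q + a ^ q ^ 3 ≠ 0 := by
  subst hq
  intro h
  have : FiniteDimensional K L := Module.finite_of_finrank_pos (by omega)
  have : Finite L := Module.finite_of_finite K
  have hs : ⇑(FiniteField.frobeniusAlgHom K L : L →+ L) = (· ^ Fintype.card K) := rfl
  have h7 : a ^ Fintype.card K ^ 7 = a := by
    have := Fintype.ofFinite L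
    simpa [Module.card_eq_pow_finrank (K := K) (V := L), hdeg] using FiniteField.pow_card a
  have htwo : (2 : L) ≠ 0 := by
    have hK : (2 : K) ≠ 0 := Ring.two_ne_zero fun hchar => by
      have := FiniteField.even_card_of_char_two hchar
      have := Nat.odd_iff.mp hodd
      omega
    simpa only [map_ofNat] using (map_ne_zero (algebraMap K L)).mpr hK
  have hfix := two_mul_map_eq_of_add_map_add_map_iterate_eq_zero
    (FiniteField.frobeniusAlgHom K L : L →+ L) (a := a)
    (by rw [hs, pow_iterate]; exact h7) (by rw [hs, pow_iterate]; exact h)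
  exact ha (FiniteField.mem_range_algebraMap_of_pow_card_eq_self (mul_left_cancel₀ htwo hfix))
end

section
/- In Λ, the vectors of the form D = C + aF − b₁E₁ − ⋯ − b₆E₆, with a a non-negative integer and each b_i ∈ {0, 1}, satisfying D·D = −1, D·(C − E₁ − E₂) ≥ 0, D·(C − E₃ − E₄) ≥ 0, D·(C − E₅ − E₆) ≥ 0 and D·(C + 2F − E₁ − E₂ − E₃ − E₄ − E₅ − E₆) ≥ 0, are exactly the eight vectors C + F − E_i − E_j − E_k with i ∈ {1,2}, j ∈ {3,4}, k ∈ {5,6}. In particular there are exactly 8 such vectors. -/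
/-- The Picard lattice of a relatively minimal conic bundle with six degenerate
fibres: the free abelian group with basis `C, F, E₁, …, E₆`, realised as
`Fin 8 → ℤ`. -/
abbrev Lam : Type := Fin 8 → ℤ

/-- The basis vector `C`. -/
def Cv : Lam := Pi.single 0 1

/-- The basis vector `F`. -/
def Fv : Lam := Pi.single 1 1

/-- The basis vector `E_{i+1}` of the paper, for `i : Fin 6`. -/
def Ev (i : Fin 6) : Lam := Pi.single i.succ.succ 1

/-- The intersection form: `C·C = 0`, `C·F = 1`, `F·F = 0`, `E_i·E_i = −1`, and
all other products of distinct basis vectors are `0`. -/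
def ip (v w : Lam) : ℤ :=
  v 0 * w 1 + v 1 * w 0 - ∑ i : Fin 6, v i.succ.succ * w i.succ.succ

/-- The set of vectors `D = C + aF − b₁E₁ − ⋯ − b₆E₆` (with `a` a non-negative
integer and each `b_i ∈ {0, 1}`) satisfying `D·D = −1`, `D·(C − E₁ − E₂) ≥ 0`,
`D·(C − E₃ − E₄) ≥ 0`, `D·(C − E₅ − E₆) ≥ 0` and
`D·(C + 2F − E₁ − E₂ − E₃ − E₄ − E₅ − E₆) ≥ 0`. -/
def negSections : Set Lam :=
  {D | ∃ (a : ℕ) (b : Fin 6 → ℤ), (∀ i, b i = 0 ∨ b i = 1) ∧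
    D = Cv + (a : ℤ) • Fv - ∑ i, b i • Ev i ∧
    ip D D = -1 ∧
    0 ≤ ip D (Cv - Ev 0 - Ev 1) ∧
    0 ≤ ip D (Cv - Ev 2 - Ev 3) ∧
    0 ≤ ip D (Cv - Ev 4 - Ev 5) ∧
    0 ≤ ip D (Cv + (2 : ℤ) • Fv - ∑ i, Ev i)}

theorem Cv_add_smul_Fv_sub_sum (a : ℤ) (b : Fin 6 → ℤ) :
    Cv + a • Fv - ∑ i, b i • Ev i = ![1, a, -b 0, -b 1, -b 2, -b 3, -b 4, -b 5] := by
  ext m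
  fin_cases m <;> simp [Cv, Fv, Ev, Fin.sum_univ_succ, Fin.ext_iff]

theorem ip_vec (x₀ x₁ x₂ x₃ x₄ x₅ x₆ x₇ y₀ y₁ y₂ y₃ y₄ y₅ y₆ y₇ : ℤ) :
    ip ![x₀, x₁, x₂, x₃, x₄, x₅, x₆, x₇] ![y₀, y₁, y₂, y₃, y₄, y₅, y₆, y₇] =
      x₀ * y₁ + x₁ * y₀ -
        (x₂ * y₂ + (x₃ * y₃ + (x₄ * y₄ + (x₅ * y₅ + (x₆ * y₆ + x₇ * y₇))))) := by
  simp [ip, Fin.sum_univ_succ]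

/-- The coordinate vectors of the eight classes `C + F − E_i − E_j − E_k`. -/
def eightSections : Finset Lam :=
  (Finset.univ : Finset (Fin 2 × Fin 2 × Fin 2)).image fun p =>
    ![1, 1, -(p.1 : ℤ), (p.1 : ℤ) - 1, -(p.2.1 : ℤ), (p.2.1 : ℤ) - 1,
      -(p.2.2 : ℤ), (p.2.2 : ℤ) - 1]

theorem card_eightSections : eightSections.card = 8 := by decide

theorem mem_eightSections_iff (D : Lam) : D ∈ eightSections ↔
    ∃ x y z : ℤ, (x = 0 ∨ x = 1) ∧ (y = 0 ∨ y = 1) ∧ (z = 0 ∨ z = 1) ∧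
      D = ![1, 1, -x, x - 1, -y, y - 1, -z, z - 1] := by
  constructor
  · simp only [eightSections, Finset.mem_image, Finset.mem_univ, true_and, Prod.exists]
    rintro ⟨x, y, z, rfl⟩
    exact ⟨(x : ℕ), (y : ℕ), (z : ℕ), by omega, by omega, by omega, rfl⟩
  · rintro ⟨x, y, z, rfl | rfl, rfl | rfl, rfl | rfl, rfl⟩ <;> decide

theorem eq_eightSections :
    {D | ∃ i ∈ ({0, 1} : Set (Fin 6)), ∃ j ∈ ({2, 3} : Set (Fin 6)),
      ∃ k ∈ ({4, 5} : Set (Fin 6)), D = Cv + Fv - Ev i - Ev j - Ev k} =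
    (eightSections : Set Lam) := by
  ext D
  rw [Finset.mem_coe, mem_eightSections_iff]
  constructor
  · rintro ⟨i, rfl | rfl, j, rfl | rfl, k, rfl | rfl, rfl⟩
    · exact ⟨1, 1, 1, by simp, by simp, by simp, by decide⟩
    · exact ⟨1, 1, 0, by simp, by simp, by simp, by decide⟩
    · exact ⟨1, 0, 1, by simp, by simp, by simp, by decide⟩
    · exact ⟨1, 0, 0, by simp, by simp, by simp, by decide⟩
    · exact ⟨0, 1, 1, by simp, by simp, by simp, by decide⟩
    · exact ⟨0, 1, 0, by simp, by simp, by simp, by decide⟩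
    · exact ⟨0, 0, 1, by simp, by simp, by simp, by decide⟩
    · exact ⟨0, 0, 0, by simp, by simp, by simp, by decide⟩
  · rintro ⟨x, y, z, hx, hy, hz, rfl⟩
    refine ⟨if x = 1 then 0 else 1, by grind, if y = 1 then 2 else 3, by grind,
      if z = 1 then 4 else 5, by grind, ?_⟩
    rcases hx with rfl | rfl <;> rcases hy with rfl | rfl <;> rcases hz with rfl | rfl <;> decide

theorem negSections_eq_eightSections : negSections = (eightSections : Set Lam) := by
  have h₀₁ : Cv - Ev 0 - Ev 1 = ![1, 0, -1, -1, 0, 0, 0, 0] := by decide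
  have h₂₃ : Cv - Ev 2 - Ev 3 = ![1, 0, 0, 0, -1, -1, 0, 0] := by decide
  have h₄₅ : Cv - Ev 4 - Ev 5 = ![1, 0, 0, 0, 0, 0, -1, -1] := by decide
  have h : Cv + (2 : ℤ) • Fv - ∑ i, Ev i = ![1, 2, -1, -1, -1, -1, -1, -1] := by
    simpa using Cv_add_smul_Fv_sub_sum 2 1
  ext D
  rw [Finset.mem_coe, mem_eightSections_iff]
  simp only [negSections, Set.mem_ofPred_eq, h₀₁, h₂₃, h₄₅, h, Cv_add_smul_Fv_sub_sum]
  constructor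
  · rintro ⟨a, b, hb, rfl, hD, h₁, h₂, h₃, h₄⟩
    rw [ip_vec] at hD h₁ h₂ h₃ h₄
    have hsq (i) : -b i * -b i = b i := by rcases hb i with h | h <;> simp [h]
    simp only [hsq] at hD
    have ha : (a : ℤ) = 1 := by linarith
    refine ⟨b 0, b 2, b 4, hb 0, hb 2, hb 4, ?_⟩
    rw [ha, show -b 1 = b 0 - 1 by linarith, show -b 3 = b 2 - 1 by linarith,
      show -b 5 = b 4 - 1 by linarith]
  · rintro ⟨x, y, z, hx, hy, hz, rfl⟩
    refine ⟨1, ![x, 1 - x, y, 1 - y, z, 1 - z], ?_, by simp, ?_⟩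
    · intro i
      fin_cases i <;> simp <;> lia
    · simp only [ip_vec]
      rcases hx with rfl | rfl <;> rcases hy with rfl | rfl <;> rcases hz with rfl | rfl <;> simp

/-- `negSections` consists exactly of the eight vectors `C + F − E_i − E_j − E_k`
with `i ∈ {1,2}`, `j ∈ {3,4}`, `k ∈ {5,6}` (here indexed by `Fin 6`, so
`i ∈ {0,1}`, `j ∈ {2,3}`, `k ∈ {4,5}`); in particular there are exactly
`8` such vectors. -/
theorem negSections_eq_eight :
    negSections =
      {D | ∃ i ∈ ({0, 1} : Set (Fin 6)), ∃ j ∈ ({2, 3} : Set (Fin 6)),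
        ∃ k ∈ ({4, 5} : Set (Fin 6)), D = Cv + Fv - Ev i - Ev j - Ev k} ∧
    negSections.ncard = 8 := by
  rw [eq_eightSections, negSections_eq_eightSections, Set.ncard_coe_finset]
  exact ⟨rfl, card_eightSections⟩
end

section
/- Set D = 2C + F − E₁ − ⋯ − E₆ ∈ Λ (so D·D = −2). Let H = 2C + aF − b₁E₁ − ⋯ − b₆E₆ with a ≥ 1 an integer and each b_i ∈ {0, 1, 2}. If H·(C − E_i) ≥ 0 for all i, H·(C + F − E_i − E_j − E_k) ≥ 0 for all 1 ≤ i < j < k ≤ 6, H·(C + 2F − Σ_{l ≠ j} E_l) ≥ 0 for all j, and H·D ≥ 0, then H·H ≥ 0. Consequently, D is the unique vector of this shape with negative self-intersection satisfying the first three families of inequalities together with the condition (H = D or H·D ≥ 0). -/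
/-- The `2`-section class `D = 2C + F − E₁ − ⋯ − E₆` (with `D·D = −2`). -/
def Dv : Lam := (2 : ℤ) • Cv + Fv - ∑ i, Ev i

theorem ip_add_right (u v w : Lam) : ip u (v + w) = ip u v + ip u w := by
  simp only [ip, Pi.add_apply, mul_add, Finset.sum_add_distrib]
  ring

theorem ip_sub_right (u v w : Lam) : ip u (v - w) = ip u v - ip u w := by
  simp only [ip, Pi.sub_apply, mul_sub, Finset.sum_sub_distrib]
  ring

theorem ip_smul_right (n : ℤ) (u v : Lam) : ip u (n • v) = n * ip u v := by
  simp only [ip, Pi.smul_apply, smul_eq_mul, mul_sub, Finset.mul_sum, mul_left_comm _ n]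
  ring

theorem ip_sum_right (s : Finset (Fin 6)) (u : Lam) (f : Fin 6 → Lam) :
    ip u (∑ i ∈ s, f i) = ∑ i ∈ s, ip u (f i) := by
  classical
  induction s using Finset.induction_on with
  | empty => simp [ip]
  | insert i s hi ih => rw [Finset.sum_insert hi, Finset.sum_insert hi, ip_add_right, ih]

theorem ip_comm (u v : Lam) : ip u v = ip v u := by
  simp only [ip, mul_comm (u _)]
  ring

theorem ip_Cv_Cv : ip Cv Cv = 0 := by decide

theorem ip_Cv_Fv : ip Cv Fv = 1 := by decide

theorem ip_Fv_Cv : ip Fv Cv = 1 := by decide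

theorem ip_Fv_Fv : ip Fv Fv = 0 := by decide

theorem ip_Cv_Ev : ∀ i, ip Cv (Ev i) = 0 := by decide

theorem ip_Fv_Ev : ∀ i, ip Fv (Ev i) = 0 := by decide

theorem ip_Ev_Cv : ∀ i, ip (Ev i) Cv = 0 := by decide

theorem ip_Ev_Fv : ∀ i, ip (Ev i) Fv = 0 := by decide

theorem ip_Ev_Ev : ∀ i j, ip (Ev i) (Ev j) = if i = j then -1 else 0 := by decide

set_option maxHeartbeats 8000000 in
/-- A class `2C + aF - ∑ bᵢEᵢ` satisfying all the positivity conditions has nonnegative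
self-intersection `4a - ∑ bᵢ²`. -/
theorem sum_sq_le_four_mul {a : ℤ} (ha : 1 ≤ a) {b : Fin 6 → ℤ}
    (hb : ∀ i, b i = 0 ∨ b i = 1 ∨ b i = 2) (h₁ : ∀ i, b i ≤ a)
    (h₂ : ∀ i j k : Fin 6, i < j → j < k → b i + b j + b k ≤ a + 2)
    (h₃ : ∀ j, ∑ l, b l - b j ≤ a + 4) (h₄ : ∑ l, b l ≤ 2 * a + 2) :
    ∑ l, b l * b l ≤ 4 * a := by
  have h012 := h₂ 0 1 2 (by decide) (by decide)
  have h013 := h₂ 0 1 3 (by decide) (by decide)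
  have h014 := h₂ 0 1 4 (by decide) (by decide)
  have h015 := h₂ 0 1 5 (by decide) (by decide)
  have h023 := h₂ 0 2 3 (by decide) (by decide)
  have h024 := h₂ 0 2 4 (by decide) (by decide)
  have h025 := h₂ 0 2 5 (by decide) (by decide)
  have h034 := h₂ 0 3 4 (by decide) (by decide)
  have h035 := h₂ 0 3 5 (by decide) (by decide)
  have h045 := h₂ 0 4 5 (by decide) (by decide)
  have h123 := h₂ 1 2 3 (by decide) (by decide)
  have h124 := h₂ 1 2 4 (by decide) (by decide)
  have h125 := h₂ 1 2 5 (by decide) (by decide)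
  have h134 := h₂ 1 3 4 (by decide) (by decide)
  have h135 := h₂ 1 3 5 (by decide) (by decide)
  have h145 := h₂ 1 4 5 (by decide) (by decide)
  have h234 := h₂ 2 3 4 (by decide) (by decide)
  have h235 := h₂ 2 3 5 (by decide) (by decide)
  have h245 := h₂ 2 4 5 (by decide) (by decide)
  have h345 := h₂ 3 4 5 (by decide) (by decide)
  have m0 := h₁ 0
  have m1 := h₁ 1
  have m2 := h₁ 2
  have m3 := h₁ 3
  have m4 := h₁ 4
  have m5 := h₁ 5
  have s0 := h₃ 0
  have s1 := h₃ 1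
  have s2 := h₃ 2
  have s3 := h₃ 3
  have s4 := h₃ 4
  have s5 := h₃ 5
  have e0 := hb 0
  have e1 := hb 1
  have e2 := hb 2
  have e3 := hb 3
  have e4 := hb 4
  have e5 := hb 5
  clear h₁ h₂ h₃ hb
  simp only [Fin.sum_univ_six] at *
  generalize b 0 = b0 at *
  generalize b 1 = b1 at *
  generalize b 2 = b2 at *
  generalize b 3 = b3 at *
  generalize b 4 = b4 at *
  generalize b 5 = b5 at *
  rcases e0 with rfl | rfl | rfl <;> rcases e1 with rfl | rfl | rfl <;>
    rcases e2 with rfl | rfl | rfl <;> rcases e3 with rfl | rfl | rfl <;>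
    rcases e4 with rfl | rfl | rfl <;> rcases e5 with rfl | rfl | rfl <;> omega

/-- Any `H = 2C + aF − b₁E₁ − ⋯ − b₆E₆` (`a ≥ 1`, `b_i ∈ {0,1,2}`) with
`H·(C − E_i) ≥ 0` for all `i`, `H·(C + F − E_i − E_j − E_k) ≥ 0` for all
`i < j < k`, `H·(C + 2F − Σ_{l ≠ j} E_l) ≥ 0` for all `j` and `H·D ≥ 0`
satisfies `H·H ≥ 0`; consequently `D` is the unique vector of this shape with
negative self-intersection satisfying the first three families of inequalities
together with the condition `H = D` or `H·D ≥ 0`. -/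
theorem two_section_unique :
    (∀ a : ℤ, 1 ≤ a → ∀ b : Fin 6 → ℤ, (∀ i, b i = 0 ∨ b i = 1 ∨ b i = 2) →
      ∀ H : Lam, H = (2 : ℤ) • Cv + a • Fv - ∑ i, b i • Ev i →
      (∀ i, 0 ≤ ip H (Cv - Ev i)) →
      (∀ i j k : Fin 6, i < j → j < k →
        0 ≤ ip H (Cv + Fv - Ev i - Ev j - Ev k)) →
      (∀ j, 0 ≤ ip H (Cv + (2 : ℤ) • Fv - ∑ l ∈ Finset.univ.erase j, Ev l)) →
      0 ≤ ip H Dv →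
      0 ≤ ip H H) ∧
    (∀ a : ℤ, 1 ≤ a → ∀ b : Fin 6 → ℤ, (∀ i, b i = 0 ∨ b i = 1 ∨ b i = 2) →
      ∀ H : Lam, H = (2 : ℤ) • Cv + a • Fv - ∑ i, b i • Ev i →
      (∀ i, 0 ≤ ip H (Cv - Ev i)) →
      (∀ i j k : Fin 6, i < j → j < k →
        0 ≤ ip H (Cv + Fv - Ev i - Ev j - Ev k)) →
      (∀ j, 0 ≤ ip H (Cv + (2 : ℤ) • Fv - ∑ l ∈ Finset.univ.erase j, Ev l)) →
      (H = Dv ∨ 0 ≤ ip H Dv) →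
      ip H H < 0 →
      H = Dv) := by
  refine (and_iff_left_of_imp fun key a ha b hb H hH h₁ h₂ h₃ h₄ hneg =>
    h₄.resolve_right fun h => hneg.not_ge (key a ha b hb H hH h₁ h₂ h₃ h)).2 ?_
  intro a ha b hb H hH h₁ h₂ h₃ h₄
  have hC : ip H Cv = a := by
    rw [ip_comm, hH]
    simp [ip_sub_right, ip_add_right, ip_smul_right, ip_sum_right,
      ip_Cv_Cv, ip_Cv_Fv, ip_Cv_Ev, -zsmul_eq_mul]
  have hF : ip H Fv = 2 := by
    rw [ip_comm, hH]
    simp [ip_sub_right, ip_add_right, ip_smul_right, ip_sum_right,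
      ip_Fv_Cv, ip_Fv_Fv, ip_Fv_Ev, -zsmul_eq_mul]
  have hE (i : Fin 6) : ip H (Ev i) = b i := by
    rw [ip_comm, hH]
    simp [ip_sub_right, ip_add_right, ip_smul_right, ip_sum_right,
      ip_Ev_Cv, ip_Ev_Fv, ip_Ev_Ev, -zsmul_eq_mul]
  have hHH : ip H H = 4 * a - ∑ i, b i * b i := by
    have h := congrArg (ip H) hH
    simp only [ip_sub_right, ip_add_right, ip_smul_right, ip_sum_right, hC, hF, hE] at h
    linarith
  simp only [Dv, ip_sub_right, ip_add_right, ip_smul_right, ip_sum_right,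
    Finset.sum_erase_eq_sub (Finset.mem_univ _), hC, hF, hE] at h₁ h₂ h₃ h₄
  rw [hHH, sub_nonneg]
  refine sum_sq_le_four_mul ha hb (fun i => ?_) (fun i j k hij hjk => ?_) (fun j => ?_) ?_
  · linarith [h₁ i]
  · linarith [h₂ i j k hij hjk]
  · linarith [h₃ j]
  · linarith
end

section
/- The Weyl group W(E₇) of the root system E₇ — equivalently, the Coxeter group defined by the Coxeter matrix of type E₇ — has exactly 60 conjugacy classes of elements. -/
namespace WeylE7

theorem card_conjClasses_eq_card {G ι : Type*} [Group G] [Finite G] [Fintype ι] (f : ι → G)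
    (hf : ∀ i j, IsConj (f i) (f j) → i = j) (c : ι → ℕ)
    (hc : ∀ i, Nat.card (Subgroup.centralizer {f i}) ≤ c i)
    (hsum : 1 ≤ ∑ i, (1 : ℚ) / c i) : Nat.card (ConjClasses G) = Fintype.card ι := by
  classical
  have := Fintype.ofFinite G
  have := Fintype.ofFinite (ConjClasses G)
  let F : ι → ConjClasses G := fun i => ConjClasses.mk (f i)
  have hinj : Function.Injective F := fun i j h =>
    hf i j (ConjClasses.mk_eq_mk_iff_isConj.mp h)
  have hG : (0 : ℚ) < Nat.card G := by exact_mod_cast Nat.card_pos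
  have hclass (i : ι) : (Nat.card G : ℚ) * (1 / c i) ≤ Nat.card (F i).carrier := by
    have h1 : Nat.card (F i).carrier * Nat.card (Subgroup.centralizer {f i}) = Nat.card G := by
      rw [Subgroup.nat_card_centralizer_nat_card_stabilizer, ← ConjAct.orbit_eq_carrier_conjClasses,
        Nat.card_eq_fintype_card, Nat.card_eq_fintype_card, Nat.card_eq_fintype_card]
      exact MulAction.card_orbit_mul_card_stabilizer_eq_card_group (ConjAct G) (f i)
    have h2 : (0 : ℚ) < c i := by
      exact_mod_cast (Nat.card_pos (α := Subgroup.centralizer {f i})).trans_le (hc i)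
    rw [mul_one_div, div_le_iff₀ h2, ← h1]
    push_cast
    gcongr
    exact_mod_cast hc i
  have hpos (x : ConjClasses G) : 0 < Nat.card x.carrier := by
    obtain ⟨g, rfl⟩ := ConjClasses.mk_surjective x
    have : Nonempty (ConjClasses.mk g).carrier := ⟨⟨g, ConjClasses.mem_carrier_mk⟩⟩
    exact Nat.card_pos
  have htot : ∑ x : ConjClasses G, Nat.card x.carrier = Nat.card G := by
    rw [Nat.card_eq_fintype_card, ← sum_conjClasses_card_eq_card]
    simp [Nat.card_eq_fintype_card]
  have himage : (Nat.card G : ℚ) ≤ ∑ x ∈ Finset.univ.image F, (Nat.card x.carrier : ℚ) := by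
    rw [Finset.sum_image hinj.injOn]
    calc (Nat.card G : ℚ) ≤ Nat.card G * ∑ i, (1 : ℚ) / c i := le_mul_of_one_le_right hG.le hsum
      _ ≤ _ := by rw [Finset.mul_sum]; exact Finset.sum_le_sum fun i _ => hclass i
  have hsurj : Finset.univ.image F = Finset.univ := by
    by_contra h
    obtain ⟨x, -, hx⟩ := Finset.exists_of_ssubset
      ((Finset.subset_univ _).ssubset_of_ne h)
    have : ∑ x ∈ Finset.univ.image F, Nat.card x.carrier < ∑ x : ConjClasses G, Nat.card x.carrier :=
      Finset.sum_lt_sum_of_subset (Finset.subset_univ _) (Finset.mem_univ x) hx (hpos x)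
        fun _ _ _ => Nat.zero_le _
    rw [htot] at this
    exact absurd (by exact_mod_cast himage) this.not_ge
  rw [Nat.card_eq_fintype_card, ← Finset.card_univ, ← hsurj, Finset.card_image_of_injective _ hinj,
    Finset.card_univ]

theorem card_subgroup_le_mul {G X : Type*} [Group G] [Finite G] (K K' : Subgroup G) (f : G → X)
    (S : Finset X) (hS : ∀ a ∈ K, f a ∈ S)
    (hK' : ∀ a ∈ K, ∀ b ∈ K, f a = f b → a⁻¹ * b ∈ K') :
    Nat.card K ≤ S.card * Nat.card K' := by
  classical
  have := Fintype.ofFinite G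
  have hcard (H : Subgroup G) : Nat.card H = (Finset.univ.filter (· ∈ H)).card := by
    rw [Nat.card_eq_fintype_card]; exact Fintype.card_subtype _
  rw [hcard, hcard, mul_comm]
  refine Finset.card_le_mul_card_image_of_maps_to (f := f) (by simpa using hS) _ fun x _ => ?_
  rcases Finset.eq_empty_or_nonempty ((Finset.univ.filter (· ∈ K)).filter fun a => f a = x)
    with h | ⟨a, ha⟩
  · simp [h]
  · simp only [Finset.mem_filter, Finset.mem_univ, true_and] at ha
    refine Finset.card_le_card_of_injOn (a⁻¹ * ·) (fun b hb => ?_) (mul_right_injective _).injOn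
    simp only [Finset.coe_filter, Finset.mem_filter, Finset.mem_univ, true_and,
      Set.mem_ofPred_eq] at hb ⊢
    exact hK' a ha.1 b hb.1 (ha.2.trans hb.2.symm)

open CoxeterMatrix

/-- The canonical Coxeter system on `W(E₇)`. -/
abbrev cs : CoxeterSystem E₇ E₇.Group := E₇.toCoxeterSystem

/-- The coefficient of `α i` in `s i (α j) - α j`. -/
def coeff (i j : Fin 7) : ℤ := if i = j then -2 else if E₇ i j = 3 then 1 else 0

/-- The matrix of the `i`-th simple reflection in the basis of simple roots. -/
def reflMatrix (i : Fin 7) : Matrix (Fin 7) (Fin 7) ℤ :=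
  Matrix.of fun k j => (if k = j then 1 else 0) + if k = i then coeff i j else 0

theorem reflMatrix_isLiftable : E₇.IsLiftable reflMatrix := by
  unfold CoxeterMatrix.IsLiftable
  decide +kernel

/-- The geometric representation of `W(E₇)`, in the basis of simple roots. -/
noncomputable def geomRep : E₇.Group →* Matrix (Fin 7) (Fin 7) ℤ :=
  cs.lift ⟨reflMatrix, reflMatrix_isLiftable⟩

theorem geomRep_simple (i : Fin 7) : geomRep (cs.simple i) = reflMatrix i :=
  cs.lift_apply_simple reflMatrix_isLiftable i

theorem geomRep_mul_simple_apply (w : E₇.Group) (i j k : Fin 7) :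
    geomRep (w * cs.simple i) k j = geomRep w k j + geomRep w k i * coeff i j := by
  rw [map_mul, geomRep_simple, Matrix.mul_apply]
  simp [reflMatrix, mul_add, Finset.sum_add_distrib]

theorem eq_or_coxeter_eq (i j : Fin 7) :
    i = j ∨ (E₇ i j = 2 ∧ coeff j i = 0) ∨ (E₇ i j = 3 ∧ coeff j i = 1 ∧ coeff i j = 1) := by
  fin_cases i <;> fin_cases j <;> decide

/-- If `ℓ w < ℓ (w sᵢ)` then `w` maps the simple root `αᵢ` to a nonnegative combination of
simple roots. -/
theorem geomRep_apply_nonneg (w : E₇.Group) (i : Fin 7)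
    (h : cs.length w < cs.length (w * cs.simple i)) (k : Fin 7) : 0 ≤ geomRep w k i := by
  induction hn : cs.length w using Nat.strong_induction_on generalizing w i with
  | _ n ih =>
    subst hn
    by_cases hw : w = 1
    · subst hw
      rw [map_one, Matrix.one_apply]
      split_ifs <;> simp
    obtain ⟨j, hj⟩ := cs.exists_rightDescent_of_ne_one hw
    unfold CoxeterSystem.IsRightDescent at hj
    obtain ⟨w', rfl⟩ : ∃ w', w = w' * cs.simple j :=
      ⟨w * cs.simple j, (cs.simple_mul_simple_cancel_right j).symm⟩
    rw [cs.simple_mul_simple_cancel_right] at hj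
    rw [geomRep_mul_simple_apply]
    have hrel := cs.simple_mul_simple_pow i j
    have h1 := cs.length_mul_simple w' j
    have h2 := cs.length_mul_simple w' i
    have h3 := cs.length_mul_simple (w' * cs.simple j) i
    have h4 := cs.length_mul_simple (w' * cs.simple i) j
    rcases eq_or_coxeter_eq i j with rfl | ⟨hM, hc⟩ | ⟨hM, hc, hc'⟩
    · simp only [cs.simple_mul_simple_cancel_right] at h
      omega
    · rw [hM, pow_two] at hrel
      have hcomm : cs.simple i * cs.simple j = cs.simple j * cs.simple i := by
        rw [eq_inv_of_mul_eq_one_left hrel, mul_inv_rev, cs.inv_simple, cs.inv_simple]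
      rw [mul_assoc, ← hcomm, ← mul_assoc] at h h3
      rw [hc, mul_zero, add_zero]
      exact ih _ hj w' i (by omega) rfl
    · rw [hM, pow_succ, pow_two] at hrel
      have hbraid : cs.simple j * cs.simple i * cs.simple j =
          cs.simple i * cs.simple j * cs.simple i := by
        have : cs.simple i * cs.simple j * cs.simple i * (cs.simple j * cs.simple i * cs.simple j)
            = 1 := by simpa only [mul_assoc] using hrel
        rw [eq_inv_of_mul_eq_one_right this]
        simp only [mul_inv_rev, cs.inv_simple, mul_assoc]
      rw [hc, mul_one]
      have hj' := ih _ hj w' j hj rfl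
      rcases h2 with h2 | h2
      · exact add_nonneg (ih _ hj w' i (by omega) rfl) hj'
      · obtain ⟨v, rfl⟩ : ∃ v, w' = v * cs.simple i :=
          ⟨w' * cs.simple i, (cs.simple_mul_simple_cancel_right i).symm⟩
        rw [cs.simple_mul_simple_cancel_right] at h2 h4
        have h5 := cs.length_mul_simple (v * cs.simple j) i
        have h6 := cs.length_mul_simple (v * cs.simple j * cs.simple i) j
        have h7 : v * cs.simple i * cs.simple j * cs.simple i =
            v * cs.simple j * cs.simple i * cs.simple j := by
          simpa only [mul_assoc] using congrArg (v * ·) hbraid.symm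
        rw [h7] at h h3
        have := ih _ (by omega) v j (by omega) rfl
        rw [geomRep_mul_simple_apply, geomRep_mul_simple_apply, hc', coeff, if_pos rfl]
        linarith

theorem geomRep_injective : Function.Injective geomRep := by
  refine (injective_iff_map_eq_one geomRep).mpr fun w hw => ?_
  by_contra hne
  obtain ⟨i, hi⟩ := cs.exists_rightDescent_of_ne_one hne
  have h := geomRep_apply_nonneg (w * cs.simple i) i
    (by rwa [cs.simple_mul_simple_cancel_right]) i
  rw [geomRep_mul_simple_apply, hw, Matrix.one_apply_eq, coeff, if_pos rfl] at h
  norm_num at h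


/-- The standard symplectic form on `𝔽₂⁶`, whose vectors are encoded by their binary digits. -/
def form (x y : Fin 64) : Bool :=
  Nat.testBit 150 (((x.val >>> 3) &&& y.val) ^^^ ((y.val >>> 3) &&& x.val))

/-- The symplectic transvection along `r`. -/
def transvection (r x : Fin 64) : Fin 64 := bif form x r then x ^^^ r else x

/-- The image of the `i`-th simple root in `𝔽₂⁶`. -/
def simpleRoot : Fin 7 → Fin 64 := ![1, 2, 8, 17, 6, 32, 4]

theorem transvection_involutive : ∀ i, Function.Involutive (transvection (simpleRoot i)) := by
  unfold Function.Involutive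
  decide +kernel

/-- The permutation of `𝔽₂⁶` induced by the `i`-th simple reflection. -/
def reflPerm (i : Fin 7) : Equiv.Perm (Fin 64) := (transvection_involutive i).toPerm

theorem reflPerm_isLiftable : E₇.IsLiftable reflPerm := by
  intro i j
  have key : ∀ i j x, ((transvection (simpleRoot i)) ∘ (transvection (simpleRoot j)))^[E₇ i j] x
      = x := by
    intro i j
    fin_cases i <;> fin_cases j <;> decide +kernel
  ext x
  rw [← Equiv.Perm.iterate_eq_pow]
  exact congrArg Fin.val (key i j x)

/-- The reduction of the geometric representation to `𝔽₂⁶`. -/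
noncomputable def modRep : E₇.Group →* Equiv.Perm (Fin 64) :=
  cs.lift ⟨reflPerm, reflPerm_isLiftable⟩

theorem modRep_simple (i : Fin 7) : modRep (cs.simple i) = reflPerm i :=
  cs.lift_apply_simple reflPerm_isLiftable i

/-- The linear automorphisms of `𝔽₂⁶` preserving the symplectic form. -/
def symplecticGroup : Subgroup (Equiv.Perm (Fin 64)) where
  carrier := {h | (∀ x y, h (x ^^^ y) = h x ^^^ h y) ∧ ∀ x y, form (h x) (h y) = form x y}
  one_mem' := by simp
  mul_mem' := by
    rintro a b ⟨ha, ha'⟩ ⟨hb, hb'⟩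
    simp [ha, ha', hb, hb']
  inv_mem' := by
    rintro a ⟨ha, ha'⟩
    refine ⟨fun x y => a.injective ?_, fun x y => ?_⟩
    · simp [ha]
    · rw [← ha']; simp

theorem reflPerm_mem_symplecticGroup : ∀ i, reflPerm i ∈ symplecticGroup := by
  intro i
  have key : ∀ i, (∀ x y, transvection (simpleRoot i) (x ^^^ y) =
      transvection (simpleRoot i) x ^^^ transvection (simpleRoot i) y) ∧
      ∀ x y, form (transvection (simpleRoot i) x) (transvection (simpleRoot i) y) = form x y := by
    decide +kernel
  exact key i

theorem modRep_mem_symplecticGroup (w : E₇.Group) : modRep w ∈ symplecticGroup := by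
  induction w using cs.simple_induction with
  | simple i => exact modRep_simple i ▸ reflPerm_mem_symplecticGroup i
  | one => exact map_one modRep ▸ one_mem _
  | mul w w' hw hw' => exact map_mul modRep w w' ▸ mul_mem hw hw'

/-- The positive root reducing to a given nonzero vector of `𝔽₂⁶`, in the basis of simple roots. -/
def posRoot (u : Fin 64) (j : Fin 7) : ℤ :=
  ((6855202853614997518429825887083289892630862830945042326960145264915040060286205614132255357164088787845192119866804686586708544369372139705612939505784269783168125080535164855344871965187993698048377965097700851372896954734099066091418240278252064246059731552859364732537694989382898469029592151184224274909281894664498946945521747201549910708741780587590321337657597566249073413072087803497587002048512 >>>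
    (3 * (7 * u.val + j.val))) % 8 : ℕ)

theorem posRoot_simpleRoot : ∀ i j, posRoot (simpleRoot i) j = if j = i then 1 else 0 := by
  decide +kernel

theorem posRoot_xor : ∀ i j, E₇ i j = 3 → ∀ k, posRoot (simpleRoot i ^^^ simpleRoot j) k =
    posRoot (simpleRoot i) k + posRoot (simpleRoot j) k := by
  intro i j
  fin_cases i <;> fin_cases j <;> decide +kernel

theorem reflMatrix_mulVec_posRoot (i : Fin 7) (u : Fin 64) :
    (reflMatrix i).mulVec (posRoot u) = posRoot (reflPerm i u) ∨
      (reflMatrix i).mulVec (posRoot u) = -posRoot (reflPerm i u) := by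
  have key : ∀ i u, (∀ k, (reflMatrix i).mulVec (posRoot u) k
      = posRoot (transvection (simpleRoot i) u) k) ∨
      ∀ k, (reflMatrix i).mulVec (posRoot u) k = -posRoot (transvection (simpleRoot i) u) k := by
    decide +kernel
  exact (key i u).imp funext funext

theorem geomRep_mulVec_posRoot (w : E₇.Group) (u : Fin 64) :
    (geomRep w).mulVec (posRoot u) = posRoot (modRep w u) ∨
      (geomRep w).mulVec (posRoot u) = -posRoot (modRep w u) := by
  induction w using cs.simple_induction generalizing u with
  | simple i =>
    rw [geomRep_simple, modRep_simple]
    exact reflMatrix_mulVec_posRoot i u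
  | one => simp
  | mul w w' hw hw' =>
    rw [map_mul, map_mul, ← Matrix.mulVec_mulVec, Equiv.Perm.mul_apply]
    rcases hw' u with h | h <;> rw [h]
    · exact hw _
    · rw [Matrix.mulVec_neg, neg_eq_iff_eq_neg, neg_inj]
      exact (hw _).symm

theorem geomRep_eq_one_or_neg_one {w : E₇.Group} (hw : modRep w = 1) :
    geomRep w = 1 ∨ geomRep w = -1 := by
  have hroot (u : Fin 64) : (geomRep w).mulVec (posRoot u) = posRoot u ∨
      (geomRep w).mulVec (posRoot u) = -posRoot u := by
    simpa [hw] using geomRep_mulVec_posRoot w u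
  have hsimple (i : Fin 7) : posRoot (simpleRoot i) = Pi.single i 1 := by
    funext j
    simp [posRoot_simpleRoot, Pi.single_apply]
  have hcol (i : Fin 7) : (∀ k, geomRep w k i = Pi.single (M := fun _ => ℤ) i 1 k) ∨
      ∀ k, geomRep w k i = -Pi.single (M := fun _ => ℤ) i 1 k := by
    have := hroot (simpleRoot i)
    rw [hsimple] at this
    simpa [funext_iff, Matrix.mulVec_single_one] using this
  have hedge (i j : Fin 7) (h : E₇ i j = 3) : geomRep w i i = geomRep w j j := by
    have hij : i ≠ j := by rintro rfl; simp at h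
    have hx : posRoot (simpleRoot i ^^^ simpleRoot j) = Pi.single i 1 + Pi.single j 1 := by
      funext k
      rw [posRoot_xor i j h, hsimple, hsimple, Pi.add_apply]
    have := hroot (simpleRoot i ^^^ simpleRoot j)
    rw [hx, Matrix.mulVec_add] at this
    simp only [Matrix.mulVec_single_one, funext_iff, Pi.add_apply, Pi.neg_apply,
      Matrix.col_apply] at this
    have hi := hcol i
    have hj := hcol j
    rcases hi with hi | hi <;> rcases hj with hj | hj <;> rcases this with h | h <;>
      have h1 := h i <;> have h2 := h j <;>
      simp [hi, hj, hij, hij.symm] at h1 h2 ⊢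
  have hdiag : ∀ i, geomRep w i i = geomRep w 0 0 := by
    have e02 := hedge 0 2 (by decide)
    have e13 := hedge 1 3 (by decide)
    have e23 := hedge 2 3 (by decide)
    have e34 := hedge 3 4 (by decide)
    have e45 := hedge 4 5 (by decide)
    have e56 := hedge 5 6 (by decide)
    intro i
    fin_cases i <;> simp [*]
  rcases hcol 0 with h0 | h0
  · left
    ext k i
    have h1 := hdiag i
    rw [h0] at h1
    rcases hcol i with h | h
    · rw [h, Matrix.one_apply, Pi.single_apply]
    · simp [h] at h1
  · right
    ext k i
    have h1 := hdiag i
    rw [h0] at h1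
    rcases hcol i with h | h
    · simp [h] at h1
    · rw [h, Matrix.neg_apply, Matrix.one_apply, Pi.single_apply]

instance : Finite modRep.ker := by
  refine Set.Finite.of_injOn (f := geomRep) (t := {1, -1}) (s := modRep.ker) ?_
    geomRep_injective.injOn (Set.toFinite _)
  exact fun w hw => geomRep_eq_one_or_neg_one hw

theorem card_modRep_ker_le : Nat.card modRep.ker ≤ 2 := by
  have h := Set.ncard_le_ncard_of_injOn (s := (modRep.ker : Set E₇.Group)) (t := {1, -1})
    geomRep (fun w hw => geomRep_eq_one_or_neg_one hw) geomRep_injective.injOn (Set.toFinite _)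
  exact h.trans (Set.ncard_insert_le _ _ |>.trans (by simp))

instance : Finite E₇.Group := by
  have : Finite (E₇.Group ⧸ modRep.ker) :=
    Finite.of_equiv _ (QuotientGroup.quotientKerEquivRange modRep).symm.toEquiv
  exact Finite.of_equiv _ (Subgroup.groupEquivQuotientProdSubgroup (s := modRep.ker)).symm

/-- The list `[x, f x, …, f^(d - 1) x]`. -/
def orbitList (f : Fin 64 → Fin 64) : ℕ → Fin 64 → List (Fin 64)
  | 0, _ => []
  | d + 1, x => x :: orbitList f d (f x)

/-- The sum of the entries of a list selected by the binary digits of `p`. -/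
def combine : List (Fin 64) → ℕ → Fin 64
  | [], _ => 0
  | x :: xs, p => bif p.testBit 0 then x ^^^ combine xs (p / 2) else combine xs (p / 2)

/-- All linear combinations of the entries of a list. -/
def spanList : List (Fin 64) → List (Fin 64)
  | [] => [0]
  | b :: bs => spanList bs ++ (spanList bs).map (b ^^^ ·)

/-- An invariant of the vector `x` under the symplectic automorphisms that commute with `f` and
fix the entries of `B`. -/
def profile (f : Fin 64 → Fin 64) (B : List (Fin 64)) (d p : ℕ) (x : Fin 64) :
    List Bool × List Bool × Option (Fin 64) :=
  ((orbitList f d x).map (form x), B.map (form x),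
    if combine (orbitList f d x) p ∈ spanList B then some (combine (orbitList f d x) p) else none)

/-- One step of a stabilizer chain: `card` bounds the number of vectors with the same profile
as `vec`. -/
structure ChainStep where
  vec : Fin 64
  depth : ℕ
  poly : ℕ
  card : ℕ

/-- Verification of a stabilizer chain. -/
def checkChain (f : Fin 64 → Fin 64) : List (Fin 64) → List ChainStep → Bool
  | B, [] => (List.finRange 64).all fun x => decide (x ∈ spanList B)
  | B, l :: ls =>
    Nat.ble ((List.finRange 64).countP fun x =>
        decide (profile f B l.depth l.poly x = profile f B l.depth l.poly l.vec)) l.card &&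
      checkChain f (B ++ orbitList f l.depth l.vec) ls

/-- The symplectic automorphisms commuting with `g` and fixing the entries of `B`. -/
def stab (g : Equiv.Perm (Fin 64)) (B : List (Fin 64)) : Subgroup (Equiv.Perm (Fin 64)) :=
  symplecticGroup ⊓ Subgroup.centralizer {g} ⊓ fixingSubgroup _ {x | x ∈ B}

theorem mem_stab {g h : Equiv.Perm (Fin 64)} {B : List (Fin 64)} :
    h ∈ stab g B ↔ h ∈ symplecticGroup ∧ (∀ x, h (g x) = g (h x)) ∧ ∀ x ∈ B, h x = x := by
  simp [stab, Subgroup.mem_inf, Subgroup.mem_centralizer_singleton_iff, mem_fixingSubgroup_iff,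
    Equiv.ext_iff, and_assoc]

theorem map_zero_of_mem {h : Equiv.Perm (Fin 64)} (hh : h ∈ symplecticGroup) : h 0 = 0 := by
  have := hh.1 0 0
  simpa using this

theorem orbitList_map {g h : Equiv.Perm (Fin 64)} (hg : ∀ x, h (g x) = g (h x)) (d : ℕ)
    (x : Fin 64) : orbitList g d (h x) = (orbitList g d x).map h := by
  induction d generalizing x with
  | zero => rfl
  | succ d ih => simp [orbitList, ← hg, ih]

theorem combine_map {h : Equiv.Perm (Fin 64)} (hh : h ∈ symplecticGroup) (l : List (Fin 64))
    (p : ℕ) : combine (l.map h) p = h (combine l p) := by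
  induction l generalizing p with
  | nil => exact (map_zero_of_mem hh).symm
  | cons x l ih =>
    rw [List.map_cons, combine, combine, ih]
    cases p.testBit 0
    · rfl
    · exact (hh.1 _ _).symm

theorem apply_eq_of_mem_spanList {h : Equiv.Perm (Fin 64)} (hh : h ∈ symplecticGroup)
    {B : List (Fin 64)} (hB : ∀ x ∈ B, h x = x) : ∀ x ∈ spanList B, h x = x := by
  induction B with
  | nil => simpa [spanList] using map_zero_of_mem hh
  | cons b B ih =>
    have ih := ih fun x hx => hB x (List.mem_cons_of_mem _ hx)
    intro x hx
    rw [spanList, List.mem_append, List.mem_map] at hx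
    rcases hx with hx | ⟨y, hy, rfl⟩
    · exact ih x hx
    · rw [hh.1, ih y hy, hB b List.mem_cons_self]

theorem profile_apply {g h : Equiv.Perm (Fin 64)} {B : List (Fin 64)} (hh : h ∈ stab g B)
    (d p : ℕ) (x : Fin 64) : profile g B d p (h x) = profile g B d p x := by
  obtain ⟨hs, hg, hB⟩ := mem_stab.mp hh
  have hspan := apply_eq_of_mem_spanList hs hB
  have hmem (y : Fin 64) : h y ∈ spanList B ↔ y ∈ spanList B :=
    ⟨fun hy => h.injective (hspan _ hy) ▸ hy, fun hy => (hspan y hy).symm ▸ hy⟩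
  unfold profile
  rw [orbitList_map hg, combine_map hs]
  refine Prod.ext ?_ (Prod.ext ?_ ?_)
  · simp [hs.2]
  · exact List.map_congr_left fun b hb => by rw [← hs.2 x b, hB b hb]
  · simp only [hmem]
    split_ifs with hy
    · rw [hspan _ hy]
    · rfl

theorem orbitList_fixed {g h : Equiv.Perm (Fin 64)} (hg : ∀ x, h (g x) = g (h x)) (d : ℕ)
    {v : Fin 64} (hv : h v = v) : ∀ x ∈ orbitList g d v, h x = x := by
  induction d generalizing v with
  | zero => simp [orbitList]
  | succ d ih =>
    simp only [orbitList, List.mem_cons, forall_eq_or_imp]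
    exact ⟨hv, ih (by rw [hg, hv])⟩

theorem card_stab_le (g : Equiv.Perm (Fin 64)) (B : List (Fin 64)) (l : List ChainStep)
    (h : checkChain g B l) : Nat.card (stab g B) ≤ (l.map ChainStep.card).prod := by
  induction l generalizing B with
  | nil =>
    have hB : ∀ x, x ∈ spanList B := by simpa [checkChain] using h
    have : stab g B = ⊥ := by
      rw [Subgroup.eq_bot_iff_forall]
      intro a ha
      obtain ⟨hs, -, hfix⟩ := mem_stab.mp ha
      exact Equiv.ext fun x => apply_eq_of_mem_spanList hs hfix x (hB x)
    simp [this]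
  | cons s l ih =>
    simp only [checkChain, Bool.and_eq_true, Nat.ble_eq] at h
    have hle := card_subgroup_le_mul (stab g B) (stab g (B ++ orbitList g s.depth s.vec))
      (fun a => a s.vec)
      ((List.finRange 64).filter fun x => decide (profile g B s.depth s.poly x =
        profile g B s.depth s.poly s.vec)).toFinset ?_ ?_
    · refine hle.trans (Nat.mul_le_mul (le_trans ?_ h.1) (ih _ h.2))
      rw [List.countP_eq_length_filter]
      exact List.toFinset_card_le _
    · intro a ha
      simpa using profile_apply ha s.depth s.poly s.vec
    · intro a ha b hb hab
      have hmem := mem_stab.mp (mul_mem (inv_mem ha) hb)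
      refine mem_stab.mpr ⟨hmem.1, hmem.2.1, fun x hx => ?_⟩
      rcases List.mem_append.mp hx with hx | hx
      · exact hmem.2.2 x hx
      · exact orbitList_fixed hmem.2.1 _ (by simp [← hab]) x hx

theorem card_centralizer_le (w : E₇.Group) (l : List ChainStep) (h : checkChain (modRep w) [] l) :
    Nat.card (Subgroup.centralizer {w}) ≤ (l.map ChainStep.card).prod * 2 := by
  classical
  have hstab := card_stab_le (modRep w) [] l h
  have hle := card_subgroup_le_mul (Subgroup.centralizer {w}) modRep.ker modRep
    (Set.toFinite (stab (modRep w) [] : Set (Equiv.Perm (Fin 64)))).toFinset ?_ ?_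
  · refine hle.trans (Nat.mul_le_mul ?_ card_modRep_ker_le)
    rw [← Nat.card_eq_card_finite_toFinset]
    exact hstab
  · intro a ha
    rw [Subgroup.mem_centralizer_singleton_iff] at ha
    have := congrArg modRep ha
    rw [map_mul, map_mul] at this
    simpa [mem_stab, modRep_mem_symplecticGroup] using Equiv.ext_iff.mp this
  · intro a _ b _ hab
    rw [MonoidHom.mem_ker, map_mul, map_inv, hab, inv_mul_cancel]

/-- A conjugacy invariant of a symplectic automorphism `f`: for `k = 1, 2, 3`, the numbers of
vectors `x` not orthogonal to `f^k x`, and of fixed vectors of `f^k`. -/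
def classInvariant (f : Fin 64 → Fin 64) : List (ℕ × ℕ) :=
  [1, 2, 3].map fun k => ((List.finRange 64).countP fun x => form x (f^[k] x),
    (List.finRange 64).countP fun x => decide (f^[k] x = x))

theorem classInvariant_eq_of_semiconj {f f' : Fin 64 → Fin 64} {h : Equiv.Perm (Fin 64)}
    (hh : h ∈ symplecticGroup) (hf : Function.Semiconj h f f') :
    classInvariant f = classInvariant f' := by
  have hperm (p : Fin 64 → Bool) :
      (List.finRange 64).countP (fun x => p (h x)) = (List.finRange 64).countP p := by
    rw [← (Equiv.Perm.map_finRange_perm h).countP_eq p, List.countP_map]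
    rfl
  unfold classInvariant
  refine List.map_congr_left fun k _ => ?_
  have hk := hf.iterate_right k
  rw [← hperm fun x => form x (f'^[k] x), ← hperm fun x => decide (f'^[k] x = x)]
  simp only [← hk _, hh.2, h.injective.eq_iff]

theorem classInvariant_eq_of_isConj {w w' : E₇.Group} (h : IsConj w w') :
    classInvariant (modRep w) = classInvariant (modRep w') := by
  obtain ⟨c, hc⟩ := isConj_iff.mp h
  refine classInvariant_eq_of_semiconj (modRep_mem_symplecticGroup c) fun x => ?_
  rw [← hc]
  simp

/-- The action of a word in the simple reflections on `𝔽₂⁶`. -/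
def evalWord (l : List (Fin 7)) (x : Fin 64) : Fin 64 :=
  l.foldr (fun i => transvection (simpleRoot i)) x

theorem modRep_wordProd (l : List (Fin 7)) : ⇑(modRep (cs.wordProd l)) = evalWord l := by
  induction l with
  | nil => rw [cs.wordProd_nil, map_one]; rfl
  | cons i l ih =>
    funext x
    rw [cs.wordProd_cons, map_mul, Equiv.Perm.mul_apply, ih, modRep_simple]
    rfl

/-- Representatives of the conjugacy classes of `W(E₇)` modulo its center, together with
stabilizer chains bounding their centralizers. -/
def representatives : List (List (Fin 7) × List ChainStep) :=
  [([],
      [⟨1, 1, 1, 63⟩, ⟨2, 1, 1, 30⟩, ⟨4, 1, 1, 12⟩, ⟨8, 1, 0, 8⟩, ⟨16, 1, 0, 4⟩, ⟨32, 1, 0, 2⟩]),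
    ([0], [⟨8, 2, 0, 32⟩, ⟨2, 1, 1, 15⟩, ⟨4, 1, 1, 6⟩, ⟨16, 1, 0, 4⟩, ⟨32, 1, 0, 2⟩]),
    ([0, 1], [⟨24, 2, 3, 16⟩, ⟨8, 2, 0, 16⟩, ⟨4, 1, 1, 3⟩, ⟨32, 1, 0, 2⟩]),
    ([0, 2], [⟨3, 3, 7, 45⟩, ⟨4, 1, 1, 6⟩, ⟨16, 1, 0, 4⟩, ⟨32, 1, 0, 2⟩]),
    ([0, 1, 2], [⟨17, 4, 0, 24⟩, ⟨4, 1, 1, 3⟩, ⟨32, 1, 0, 2⟩]),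
    ([0, 2, 3], [⟨2, 4, 0, 32⟩, ⟨4, 1, 1, 3⟩, ⟨32, 1, 0, 2⟩]),
    ([0, 1, 2, 3], [⟨5, 5, 31, 15⟩, ⟨32, 1, 0, 2⟩]),
    ([0, 1, 4], [⟨16, 2, 3, 24⟩, ⟨32, 2, 0, 8⟩, ⟨8, 2, 0, 2⟩]),
    ([0, 1, 2, 4], [⟨17, 4, 9, 12⟩, ⟨32, 2, 0, 4⟩]),
    ([0, 1, 3, 4], [⟨32, 4, 0, 16⟩, ⟨8, 2, 0, 2⟩]),
    ([1, 2, 3, 4], [⟨1, 4, 9, 36⟩, ⟨32, 2, 0, 4⟩]),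
    ([0, 1, 2, 3, 4], [⟨32, 6, 0, 16⟩]),
    ([0, 1, 2, 3, 5], [⟨5, 6, 0, 10⟩]),
    ([0, 2, 4, 5], [⟨3, 3, 7, 18⟩, ⟨16, 3, 0, 6⟩]),
    ([0, 1, 2, 4, 5], [⟨16, 4, 0, 12⟩, ⟨1, 2, 0, 3⟩]),
    ([0, 2, 3, 4, 5], [⟨3, 6, 0, 12⟩]),
    ([0, 1, 2, 3, 4, 5], [⟨1, 6, 0, 12⟩]),
    ([1, 4, 6], [⟨16, 2, 3, 48⟩, ⟨32, 2, 0, 16⟩, ⟨1, 1, 1, 3⟩, ⟨8, 1, 0, 2⟩]),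
    ([1, 3, 4, 6], [⟨32, 4, 0, 32⟩, ⟨1, 1, 1, 3⟩, ⟨8, 1, 0, 2⟩]),
    ([0, 2, 3, 5, 6], [⟨6, 6, 0, 24⟩]),
    ([0, 1, 2, 3, 5, 6], [⟨5, 6, 0, 15⟩]),
    ([0, 1, 2, 4, 5, 6], [⟨17, 6, 0, 24⟩]),
    ([1, 3, 4, 5, 6], [⟨3, 5, 21, 18⟩, ⟨8, 1, 0, 2⟩]),
    ([0, 2, 3, 4, 5, 6], [⟨1, 6, 0, 7⟩]),
    ([0, 1, 2, 3, 4, 5, 6], [⟨1, 6, 0, 9⟩]),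
    ([0, 1, 2, 3, 4, 5, 0, 1, 2, 3, 4, 5, 0, 1, 2, 3, 4, 5, 0, 1, 2, 3, 4, 5],
      [⟨3, 2, 1, 27⟩, ⟨4, 2, 0, 8⟩, ⟨1, 2, 0, 3⟩]),
    ([3, 4, 1, 3, 6, 4, 2], [⟨1, 3, 0, 16⟩, ⟨32, 3, 0, 8⟩]),
    ([1, 2, 3, 4, 2, 3], [⟨1, 3, 0, 48⟩, ⟨32, 3, 0, 8⟩]),
    ([6, 4, 5, 2, 3, 2, 1, 3], [⟨1, 6, 0, 16⟩]),
    ([1, 3, 2, 1, 6, 4, 3, 0, 0, 2, 0, 2, 2, 6, 5, 4, 5, 2], [⟨1, 4, 0, 24⟩, ⟨2, 2, 0, 3⟩])]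

theorem representatives_length : representatives.length = 30 := rfl

theorem checkChain_representatives :
    representatives.all (fun r => checkChain (evalWord r.1) [] r.2) = true := by
  decide +kernel

theorem classInvariant_nodup :
    (representatives.map fun r => classInvariant (evalWord r.1)).Nodup := by
  decide +kernel

/-- A word for the longest element of `W(E₇)`. -/
def longestWord : List (Fin 7) := (List.replicate 9 (List.finRange 7)).flatten

theorem modRep_longestWord : modRep (cs.wordProd longestWord) = 1 := by
  have key : ∀ x, evalWord longestWord x = x := by decide +kernel
  exact Equiv.ext fun x => (congrFun (modRep_wordProd longestWord) x).trans (key x)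

/-- The words representing the conjugacy classes of `W(E₇)`. -/
def repWord (i : Fin 30 × Bool) : List (Fin 7) :=
  (representatives.get (i.1.cast representatives_length.symm)).1 ++
    bif i.2 then longestWord else []

theorem modRep_repWord (i : Fin 30 × Bool) : modRep (cs.wordProd (repWord i)) =
    modRep (cs.wordProd (representatives.get (i.1.cast representatives_length.symm)).1) := by
  rw [repWord, cs.wordProd_append, map_mul]
  cases i.2
  · simp
  · simp [modRep_longestWord]

theorem eq_of_isConj_repWord (i j : Fin 30 × Bool)
    (h : IsConj (cs.wordProd (repWord i)) (cs.wordProd (repWord j))) : i = j := by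
  have h1 : i.1 = j.1 := by
    have hinv := classInvariant_eq_of_isConj h
    rw [modRep_repWord, modRep_repWord, modRep_wordProd, modRep_wordProd] at hinv
    have := List.nodup_iff_injective_get.mp classInvariant_nodup
    have := @this (i.1.cast (by simp [representatives_length]))
      (j.1.cast (by simp [representatives_length])) (by simpa using hinv)
    simpa [Fin.ext_iff] using this
  have h2 : i.2 = j.2 := by
    have hpar := isConj_iff_eq.mp (cs.lengthParity.map_isConj h)
    have hword (l : List (Fin 7)) :
        cs.lengthParity (cs.wordProd l) = Multiplicative.ofAdd (l.length : ZMod 2) := by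
      induction l with
      | nil => simp
      | cons a l ih =>
        rw [cs.wordProd_cons, map_mul, ih, cs.lengthParity_simple, ← ofAdd_add]
        simp [add_comm]
    rw [hword, hword, Multiplicative.ofAdd.apply_eq_iff_eq, repWord, repWord, h1] at hpar
    simp only [List.length_append, Nat.cast_add, add_right_inj] at hpar
    revert hpar
    cases i.2 <;> cases j.2 <;> decide
  exact Prod.ext h1 h2

/-- An upper bound for the order of the centralizer of `repWord i`. -/
def centralizerBound (i : Fin 30 × Bool) : ℕ :=
  ((representatives.get (i.1.cast representatives_length.symm)).2.map ChainStep.card).prod * 2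

theorem card_centralizer_repWord_le (i : Fin 30 × Bool) :
    Nat.card (Subgroup.centralizer {cs.wordProd (repWord i)}) ≤ centralizerBound i := by
  apply card_centralizer_le
  rw [modRep_repWord, modRep_wordProd]
  exact List.all_eq_true.mp checkChain_representatives _ (List.get_mem _ _)

theorem one_le_sum_inv_centralizerBound :
    1 ≤ ∑ i : Fin 30 × Bool, (1 : ℚ) / centralizerBound i := by
  decide +kernel

end WeylE7

/-- The Weyl group `W(E₇)`, i.e. the Coxeter group defined by the Coxeter matrix of
type `E₇`, has exactly `60` conjugacy classes of elements. -/
theorem weylE7_num_conjClasses :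
    Nat.card (ConjClasses (CoxeterMatrix.E₇.Group)) = 60 :=
  (WeylE7.card_conjClasses_eq_card _ WeylE7.eq_of_isConj_repWord _
    WeylE7.card_centralizer_repWord_le WeylE7.one_le_sum_inv_centralizerBound).trans rfl
end
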